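/- Let U = (T, G, H) be an itKI_c1-algebra. Then the maps S ↦ D_S := {u ∈ T : ∼u⇒c ∈ S and ⊤⇒(u⊔c) ∈ S} and D ↦ S_D := D ∩ C(T) are mutually inverse, inclusion-preserving bijections (an order isomorphism) between the set of tense 1-filters of C(U) and the set of centered tense deductive systems of U. -/

import Mathlib

/-- A tense KI-algebra: a centered Kleene algebra with an implication ⇒
satisfying (KI1)-(KI5), together with tense operators G, H satisfying
(t1)-(t6), where F x := ∼G(∼x) and P x := ∼H(∼x). -/
structure TenseKI (T : Type*) [DistribLattice T] [BoundedOrder T] where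
  neg : T → T
  c : T
  imp : T → T → T
  neg_neg : ∀ x : T, neg (neg x) = x
  neg_sup : ∀ x y : T, neg (x ⊔ y) = neg x ⊓ neg y
  kleene : ∀ x y : T, x ⊓ neg x ≤ y ⊔ neg y
  neg_c : neg c = c
  KI1a : ∀ x y z : T, imp x y ⊓ imp x z = imp x (y ⊓ z)
  KI1b : ∀ x y z : T, imp x z ⊓ imp y z = imp (x ⊔ y) z
  KI1c : ∀ x : T, imp ⊥ x = ⊤
  KI1d : ∀ x : T, imp x ⊤ = ⊤
  KI2 : ∀ x y : T, (x ⊓ imp x y) ⊔ c ≤ y ⊔ c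
  KI3 : imp c c = ⊤
  KI4 : ∀ x y : T, imp x y ⊓ c = (neg x ⊔ y) ⊓ c
  KI5 : ∀ x y : T, imp x (neg y) ⊔ c = imp x (neg y ⊔ c) ⊓ imp y (neg x ⊔ c)
  G : T → T
  H : T → T
  t1G : G ⊤ = ⊤
  t1H : H ⊤ = ⊤
  t2G : ∀ x y : T, G (x ⊓ y) = G x ⊓ G y
  t2H : ∀ x y : T, H (x ⊓ y) = H x ⊓ H y
  t3G : ∀ x : T, x ≤ G (neg (H (neg x)))
  t3H : ∀ x : T, x ≤ H (neg (G (neg x)))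
  t4G : ∀ x y : T, G (x ⊔ y) ≤ G x ⊔ neg (G (neg y))
  t4H : ∀ x y : T, H (x ⊔ y) ≤ H x ⊔ neg (H (neg y))
  t5G : ∀ x y : T, G (imp x y) ≤ imp (G x) (G y)
  t5H : ∀ x y : T, H (imp x y) ≤ imp (H x) (H y)
  t6G : ∀ x y : T, G (imp x y) ≤ imp (neg (G (neg x))) (neg (G (neg y)))
  t6H : ∀ x y : T, H (imp x y) ≤ imp (neg (H (neg x))) (neg (H (neg y)))

/-- F x := ∼G(∼x). -/
def TenseKI.F {T : Type*} [DistribLattice T] [BoundedOrder T] (K : TenseKI T) (x : T) : T :=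
  K.neg (K.G (K.neg x))

/-- P x := ∼H(∼x). -/
def TenseKI.P {T : Type*} [DistribLattice T] [BoundedOrder T] (K : TenseKI T) (x : T) : T :=
  K.neg (K.H (K.neg x))

/-- An itKI_c1-algebra: a tense centered KI-algebra satisfying x ⇒ x = ⊤
and the interpolation condition (CK). -/
structure ItKIc1 (T : Type*) [DistribLattice T] [BoundedOrder T] extends TenseKI T where
  Gc : G c = c
  Hc : H c = c
  imp_self : ∀ x : T, imp x x = ⊤
  CK : ∀ x y : T, c ≤ x → c ≤ y → x ⊓ y ≤ c → ∃ z : T, z ⊔ c = x ∧ neg z ⊔ c = y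

section
variable {T : Type*} [DistribLattice T] [BoundedOrder T]

/-- F on an itKI_c1-algebra. -/
abbrev ItKIc1.F (K : ItKIc1 T) : T → T := K.toTenseKI.F

/-- P on an itKI_c1-algebra. -/
abbrev ItKIc1.P (K : ItKIc1 T) : T → T := K.toTenseKI.P

/-- A congruence of an itKI_c1-algebra: an equivalence relation compatible
with ⊓, ⊔, ⇒, ∼, G, H. -/
def ItKIc1.IsCongrU (K : ItKIc1 T) (ε : T → T → Prop) : Prop :=
  Equivalence ε ∧
  (∀ a b x y : T, ε a b → ε x y →
    ε (a ⊓ x) (b ⊓ y) ∧ ε (a ⊔ x) (b ⊔ y) ∧ ε (K.imp a x) (K.imp b y)) ∧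
  (∀ a b : T, ε a b → ε (K.neg a) (K.neg b) ∧ ε (K.G a) (K.G b) ∧ ε (K.H a) (K.H b))

/-- A tense 1-filter of C(U): a lattice filter S of C(T) = {x : c ≤ x} with
((a⊓f)⇒b)⇒(a⇒b) ∈ S for all a, b ∈ C(T), f ∈ S, closed under G and H. -/
def ItKIc1.IsTense1FilterC (K : ItKIc1 T) (S : Set T) : Prop :=
  (∀ x ∈ S, K.c ≤ x) ∧ S.Nonempty ∧
  (∀ x ∈ S, ∀ y : T, K.c ≤ y → x ≤ y → y ∈ S) ∧
  (∀ x ∈ S, ∀ y ∈ S, x ⊓ y ∈ S) ∧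
  (∀ a b : T, K.c ≤ a → K.c ≤ b → ∀ f ∈ S,
    K.imp (K.imp (a ⊓ f) b) (K.imp a b) ∈ S) ∧
  (∀ x ∈ S, K.G x ∈ S) ∧ (∀ x ∈ S, K.H x ∈ S)

/-- A tense deductive system of U: contains ⊤, closed under modus ponens
and under G and H. -/
def ItKIc1.IsTDS (K : ItKIc1 T) (D : Set T) : Prop :=
  ⊤ ∈ D ∧ (∀ u ∈ D, ∀ v : T, K.imp u v ∈ D → v ∈ D) ∧
  (∀ u ∈ D, K.G u ∈ D ∧ K.H u ∈ D)

/-- A centered tense deductive system: a tense deductive system D such that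
(ctD1) D ∩ C(T) is a tense 1-filter of C(U) and (ctD2) ∼u⇒c ∈ D and
⊤⇒(u⊔c) ∈ D imply u ∈ D. -/
def ItKIc1.IsCTDS (K : ItKIc1 T) (D : Set T) : Prop :=
  K.IsTDS D ∧ K.IsTense1FilterC (D ∩ {x | K.c ≤ x}) ∧
  (∀ u : T, K.imp (K.neg u) K.c ∈ D → K.imp ⊤ (u ⊔ K.c) ∈ D → u ∈ D)

end

section
variable {T : Type*} [DistribLattice T] [BoundedOrder T]

/-- The map S ↦ D_S. -/
def dOf (K : ItKIc1 T) (S : Set T) : Set T :=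
  {u : T | K.imp (K.neg u) K.c ∈ S ∧ K.imp ⊤ (u ⊔ K.c) ∈ S}

/-- The map D ↦ S_D = D ∩ C(T). -/
def sOf (K : ItKIc1 T) (D : Set T) : Set T := D ∩ {x | K.c ≤ x}

end

namespace ItKIc1

variable {T : Type*} [DistribLattice T] [BoundedOrder T] (K : ItKIc1 T)

theorem imp_le_imp_left {y z : T} (x : T) (h : y ≤ z) : K.imp x y ≤ K.imp x z := by
  have h₁ := K.KI1a x y z
  rw [inf_eq_left.2 h] at h₁
  exact inf_eq_left.1 h₁

theorem imp_le_imp_right {x y : T} (z : T) (h : x ≤ y) : K.imp y z ≤ K.imp x z := by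
  have h₁ := K.KI1b x y z
  rw [sup_eq_right.2 h] at h₁
  exact inf_eq_right.1 h₁

theorem imp_eq_top {x y : T} (h : x ≤ y) : K.imp x y = ⊤ :=
  top_le_iff.1 ((K.imp_self x).ge.trans (K.imp_le_imp_left x h))

theorem inf_imp_le {x y : T} (h : K.c ≤ y) : x ⊓ K.imp x y ≤ y := by
  have h₁ := K.KI2 x y
  rw [sup_eq_left.2 h] at h₁
  exact le_sup_left.trans h₁

theorem c_le_imp {x y : T} (h : K.c ≤ y) : K.c ≤ K.imp x y := by
  have h₁ := K.KI4 x y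
  rw [inf_eq_right.2 (h.trans le_sup_right)] at h₁
  exact inf_eq_right.1 h₁

theorem imp_top_le {x : T} (h : K.c ≤ x) : K.imp ⊤ x ≤ x := by
  simpa using K.inf_imp_le (x := ⊤) h

theorem sup_c_imp {x y : T} (h : K.c ≤ y) : K.imp (x ⊔ K.c) y = K.imp x y := by
  rw [← K.KI1b, K.imp_eq_top h, inf_top_eq]

theorem neg_le_c {x : T} (h : K.c ≤ x) : K.neg x ≤ K.c := by
  have h₁ := K.neg_sup x K.c
  rw [sup_eq_left.2 h, K.neg_c] at h₁
  exact inf_eq_left.1 h₁.symm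

theorem imp_sup_c_eq (x y : T) :
    K.imp x y ⊔ K.c = K.imp x (y ⊔ K.c) ⊓ K.imp (K.neg y) (K.neg x ⊔ K.c) := by
  simpa only [K.neg_neg] using K.KI5 x (K.neg y)

theorem inf_neg_le_c (x : T) : x ⊓ K.neg x ≤ K.c := by
  simpa only [K.neg_c, sup_idem] using K.kleene x K.c

namespace IsTense1FilterC

variable {K} {S : Set T} (hS : K.IsTense1FilterC S)
include hS

theorem mem_of_le {x y : T} (hx : x ∈ S) (h : x ≤ y) : y ∈ S :=
  hS.2.2.1 x hx y ((hS.1 x hx).trans h) h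

theorem inf_mem {x y : T} (hx : x ∈ S) (hy : y ∈ S) : x ⊓ y ∈ S := hS.2.2.2.1 x hx y hy

theorem top_mem : ⊤ ∈ S :=
  let ⟨_, hx⟩ := hS.2.1
  hS.mem_of_le hx le_top

theorem imp_mem_of_inf_le {a b f : T} (ha : K.c ≤ a) (hb : K.c ≤ b) (hf : f ∈ S)
    (h : a ⊓ f ≤ b) : K.imp a b ∈ S := by
  have h₁ := hS.2.2.2.2.1 a b ha hb f hf
  rw [K.imp_eq_top h] at h₁
  exact hS.mem_of_le h₁ (K.imp_top_le (K.c_le_imp hb))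

theorem imp_top_mem_iff {x : T} (h : K.c ≤ x) : K.imp ⊤ x ∈ S ↔ x ∈ S :=
  ⟨fun hx => hS.mem_of_le hx (K.imp_top_le h),
    fun hx => hS.imp_mem_of_inf_le le_top h hx inf_le_right⟩

theorem mem_of_imp_mem {x y : T} (h : K.c ≤ y) (hx : x ∈ S) (hxy : K.imp x y ∈ S) : y ∈ S :=
  hS.mem_of_le (hS.inf_mem hx hxy) (K.inf_imp_le h)

theorem imp_trans_mem {x y z : T} (hx : K.c ≤ x) (hy : K.c ≤ y) (hz : K.c ≤ z)
    (hxy : K.imp x y ∈ S) (hyz : K.imp y z ∈ S) : K.imp x z ∈ S := by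
  refine hS.imp_mem_of_inf_le hx hz (hS.inf_mem hxy hyz) ?_
  rw [← inf_assoc]
  exact (inf_le_inf_right _ (K.inf_imp_le hy)).trans (K.inf_imp_le hz)

theorem mem_dOf_iff {u : T} :
    u ∈ dOf K S ↔ K.imp (K.neg u) K.c ∈ S ∧ u ⊔ K.c ∈ S :=
  and_congr_right fun _ => hS.imp_top_mem_iff le_sup_right

theorem mem_dOf_iff_of_c_le {u : T} (hu : K.c ≤ u) : u ∈ dOf K S ↔ u ∈ S := by
  rw [hS.mem_dOf_iff, K.imp_eq_top (K.neg_le_c hu), sup_eq_left.2 hu]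
  exact and_iff_right hS.top_mem

theorem sOf_dOf : sOf K (dOf K S) = S := by
  ext u
  exact ⟨fun h => (hS.mem_dOf_iff_of_c_le h.2).1 h.1,
    fun h => ⟨(hS.mem_dOf_iff_of_c_le (hS.1 u h)).2 h, hS.1 u h⟩⟩

theorem dOf_modus_ponens {u v : T} (hu : u ∈ dOf K S) (huv : K.imp u v ∈ dOf K S) :
    v ∈ dOf K S := by
  rw [hS.mem_dOf_iff] at hu huv ⊢
  have h := huv.2
  rw [K.imp_sup_c_eq] at h
  have h₁ := hS.mem_of_le h inf_le_left
  have h₂ := hS.mem_of_le h inf_le_right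
  rw [← K.sup_c_imp le_sup_right] at h₁ h₂
  have h₃ := hu.1
  rw [← K.sup_c_imp le_rfl] at h₃ ⊢
  exact ⟨hS.imp_trans_mem le_sup_right le_sup_right le_rfl h₂ h₃,
    hS.mem_of_imp_mem le_sup_right hu.2 h₁⟩

theorem G_mem_dOf {u : T} (hu : u ∈ dOf K S) : K.G u ∈ dOf K S := by
  constructor
  · have h := hS.mem_of_le (hS.2.2.2.2.2.1 _ hu.1) (K.t6G _ _)
    rwa [K.neg_neg, K.neg_c, K.Gc, K.neg_c] at h
  · have h := hS.mem_of_le (hS.2.2.2.2.2.1 _ hu.2) (K.t5G _ _)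
    have h₁ := K.t4G u K.c
    rw [K.neg_c, K.Gc, K.neg_c] at h₁
    rw [K.t1G] at h
    exact hS.mem_of_le h (K.imp_le_imp_left _ h₁)

theorem H_mem_dOf {u : T} (hu : u ∈ dOf K S) : K.H u ∈ dOf K S := by
  constructor
  · have h := hS.mem_of_le (hS.2.2.2.2.2.2 _ hu.1) (K.t6H _ _)
    rwa [K.neg_neg, K.neg_c, K.Hc, K.neg_c] at h
  · have h := hS.mem_of_le (hS.2.2.2.2.2.2 _ hu.2) (K.t5H _ _)
    have h₁ := K.t4H u K.c
    rw [K.neg_c, K.Hc, K.neg_c] at h₁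
    rw [K.t1H] at h
    exact hS.mem_of_le h (K.imp_le_imp_left _ h₁)

theorem isCTDS_dOf : K.IsCTDS (dOf K S) := by
  refine ⟨⟨?_, fun u hu v huv => hS.dOf_modus_ponens hu huv,
    fun u hu => ⟨hS.G_mem_dOf hu, hS.H_mem_dOf hu⟩⟩, ?_, fun u h₁ h₂ => ⟨?_, ?_⟩⟩
  · exact (hS.mem_dOf_iff_of_c_le le_top).2 hS.top_mem
  · exact (congrArg K.IsTense1FilterC hS.sOf_dOf).mpr hS
  · exact (hS.mem_dOf_iff_of_c_le (K.c_le_imp le_rfl)).1 h₁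
  · exact (hS.mem_dOf_iff_of_c_le (K.c_le_imp le_sup_right)).1 h₂

end IsTense1FilterC

theorem IsCTDS.dOf_sOf {K : ItKIc1 T} {D : Set T} (hD : K.IsCTDS D) :
    dOf K (sOf K D) = D := by
  have hS : K.IsTense1FilterC (sOf K D) := hD.2.1
  ext u
  refine ⟨fun h => hD.2.2 u h.1.1 h.2.1, fun hu => ?_⟩
  have huc : u ⊔ K.c ∈ sOf K D :=
    ⟨hD.1.2.1 u hu _ (by rw [K.imp_eq_top le_sup_left]; exact hD.1.1), le_sup_right⟩
  rw [hS.mem_dOf_iff, ← K.sup_c_imp le_rfl]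
  refine ⟨hS.imp_mem_of_inf_le le_sup_right le_rfl huc ?_, huc⟩
  rw [← sup_inf_right, inf_comm]
  exact sup_le (K.inf_neg_le_c u) le_rfl

end ItKIc1

section
variable {T : Type*} [DistribLattice T] [BoundedOrder T] (K : ItKIc1 T)

theorem dOf_mono {S₁ S₂ : Set T} (h : S₁ ⊆ S₂) : dOf K S₁ ⊆ dOf K S₂ :=
  fun _ hu => ⟨h hu.1, h hu.2⟩

theorem sOf_mono {D₁ D₂ : Set T} (h : D₁ ⊆ D₂) : sOf K D₁ ⊆ sOf K D₂ :=
  Set.inter_subset_inter_left _ h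

end

/-- The maps S ↦ D_S and D ↦ S_D are mutually inverse, inclusion-preserving
bijections between tense 1-filters of C(U) and centered tense deductive
systems of U. -/
theorem stmt17 {T : Type*} [DistribLattice T] [BoundedOrder T] (K : ItKIc1 T) :
    (∀ S : Set T, K.IsTense1FilterC S → K.IsCTDS (dOf K S)) ∧
    (∀ D : Set T, K.IsCTDS D → K.IsTense1FilterC (sOf K D)) ∧
    (∀ S : Set T, K.IsTense1FilterC S → sOf K (dOf K S) = S) ∧
    (∀ D : Set T, K.IsCTDS D → dOf K (sOf K D) = D) ∧
    (∀ S₁ S₂ : Set T, K.IsTense1FilterC S₁ → K.IsTense1FilterC S₂ →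
      (S₁ ⊆ S₂ ↔ dOf K S₁ ⊆ dOf K S₂)) ∧
    (∀ D₁ D₂ : Set T, K.IsCTDS D₁ → K.IsCTDS D₂ →
      (D₁ ⊆ D₂ ↔ sOf K D₁ ⊆ sOf K D₂)) := by
  refine ⟨fun S hS => hS.isCTDS_dOf, fun D hD => hD.2.1, fun S hS => hS.sOf_dOf,
    fun D hD => hD.dOf_sOf, fun S₁ S₂ h₁ h₂ => ⟨dOf_mono K, fun h => ?_⟩,
    fun D₁ D₂ h₁ h₂ => ⟨sOf_mono K, fun h => ?_⟩⟩
  · rw [← h₁.sOf_dOf, ← h₂.sOf_dOf]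
    exact sOf_mono K h
  · rw [← h₁.dOf_sOf, ← h₂.dOf_sOf]
    exact dOf_mono K h
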